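/- arXiv:math/0407109 — 3 statements merged into one kernel-verified Lean document; each statement's English description precedes it below -/
import Mathlib

section
/- Let μ ∈ ℝ, v > 0, and let X be a random variable distributed according to the Gaussian measure on ℝ with mean μ and variance v. Let 0 < ε < 1 and let κ ∈ ℝ satisfy Φ(κ) = 1 − ε, where Φ is the cumulative distribution function of the standard Gaussian measure on ℝ. Then sup { γ ∈ ℝ : P(X ≥ γ) ≥ 1 − ε } = μ − κ·√v, and this supremum is attained: the optimal value of the Value-At-Risk problem 'maximize γ subject to P(X ≥ γ) ≥ 1 − ε' equals the mean of X minus κ times its standard deviation. -/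
open MeasureTheory ProbabilityTheory

theorem strictMono_cdf_gaussianReal (μ : ℝ) {v : NNReal} (hv : v ≠ 0) :
    StrictMono (cdf (gaussianReal μ v)) := by
  intro a b hab
  have hpos : gaussianReal μ v (Set.Ioc a b) ≠ 0 := fun h => by
    have hvol := gaussianReal_absolutelyContinuous' μ hv h
    rw [Real.volume_Ioc, ENNReal.ofReal_eq_zero] at hvol
    linarith
  rw [← measure_cdf (gaussianReal μ v), StieltjesFunction.measure_Ioc] at hpos
  by_contra! hle
  exact hpos (ENNReal.ofReal_eq_zero.2 (by linarith))

theorem gaussianReal_Ici_sub_mul_sqrt (μ : ℝ) {v : NNReal} (hv : 0 < v) (t : ℝ) :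
    gaussianReal μ v (Set.Ici (μ - t * Real.sqrt v)) = gaussianReal 0 1 (Set.Iic t) := by
  have hs : 0 < Real.sqrt v := Real.sqrt_pos.2 (by exact_mod_cast hv)
  have hmap : (gaussianReal 0 1).map (fun x => μ - Real.sqrt v * x) = gaussianReal μ v := by
    have hcomp : (fun x => μ - Real.sqrt v * x) =
        (fun x => μ - x) ∘ (fun x => Real.sqrt v * x) := rfl
    rw [hcomp, ← Measure.map_map (by fun_prop) (by fun_prop), gaussianReal_map_const_mul,
      gaussianReal_map_const_sub]
    congr 1
    · simp
    · ext
      simp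
  rw [← hmap, Measure.map_apply (by fun_prop) measurableSet_Ici]
  congr 1
  ext x
  simp only [Set.mem_preimage, Set.mem_Ici, Set.mem_Iic, sub_le_sub_iff_left]
  rw [mul_comm t, mul_le_mul_iff_right₀ hs]

/-- **The Gaussian VaR problem has value μ - κ·√v, attained.**
If `X` is Gaussian with mean `μ` and variance `v > 0`, `0 < ε < 1` and `Φ(κ) = 1 - ε` with `Φ`
the standard Gaussian cdf, then the chance-constrained problem
`max { γ : P(X ≥ γ) ≥ 1 - ε }` has optimal value `μ - κ·√v`, and the supremum is attained. -/
theorem stmt3 {Ω : Type*} [MeasurableSpace Ω] (P : Measure Ω) [IsProbabilityMeasure P]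
    (X : Ω → ℝ) (μ : ℝ) (v : NNReal) (hv : 0 < v)
    (hX : Measure.map X P = gaussianReal μ v)
    (ε : ℝ) (hε0 : 0 < ε) (hε1 : ε < 1) (κ : ℝ)
    (hκ : cdf (gaussianReal 0 1) κ = 1 - ε) :
    IsGreatest {γ : ℝ | ENNReal.ofReal (1 - ε) ≤ P {ω | γ ≤ X ω}} (μ - κ * Real.sqrt v) ∧
      sSup {γ : ℝ | ENNReal.ofReal (1 - ε) ≤ P {ω | γ ≤ X ω}} = μ - κ * Real.sqrt v := by
  have hs : 0 < Real.sqrt v := Real.sqrt_pos.2 (by exact_mod_cast hv)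
  have hXm : AEMeasurable X P := by
    refine AEMeasurable.of_map_ne_zero ?_
    rw [hX]
    exact IsProbabilityMeasure.ne_zero _
  have key (t : ℝ) : ENNReal.ofReal (1 - ε) ≤ P {ω | μ - t * Real.sqrt v ≤ X ω} ↔ κ ≤ t := by
    have hP : P {ω | μ - t * Real.sqrt v ≤ X ω} =
        gaussianReal μ v (Set.Ici (μ - t * Real.sqrt v)) := by
      rw [← hX, Measure.map_apply_of_aemeasurable hXm measurableSet_Ici]
      rfl
    rw [hP, gaussianReal_Ici_sub_mul_sqrt μ hv, ← ofReal_cdf, ← hκ,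
      ENNReal.ofReal_le_ofReal_iff (cdf_nonneg _ _),
      (strictMono_cdf_gaussianReal 0 one_ne_zero).le_iff_le]
  have hmax : IsGreatest {γ : ℝ | ENNReal.ofReal (1 - ε) ≤ P {ω | γ ≤ X ω}}
      (μ - κ * Real.sqrt v) := by
    refine ⟨(key κ).2 le_rfl, fun γ hγ => ?_⟩
    have hγt : γ = μ - (μ - γ) / Real.sqrt v * Real.sqrt v := by
      rw [div_mul_cancel₀ _ hs.ne']
      ring
    rw [Set.mem_ofPred_eq, hγt, key, le_div_iff₀ hs] at hγ
    linarith
  exact ⟨hmax, hmax.csSup_eq⟩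
end

section
/- Let U be a nonempty set, f : U → ℝ, A : U → ℝ^D, and suppose that for every λ ∈ ℝ^D the function u ↦ f(u) − λᵀ A(u) is bounded below on U. Let d̄ ∈ ℝ^D, let Γ be a symmetric positive definite D×D real matrix, κ ≥ 0, and E(d̄, Γ, κ) := { x ∈ ℝ^D : (x − d̄)ᵀ Γ⁻¹ (x − d̄) ≤ κ² }. Then for every λ ∈ ℝ^D the Lagrangian dual function of the relaxed problem satisfies: inf { f(u) + λᵀ( d − A(u) ) : u ∈ U, d ∈ E(d̄, Γ, κ) } = inf_{u ∈ U} ( f(u) − λᵀ A(u) ) + λᵀ d̄ − κ·√(λᵀ Γ λ). -/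
open Matrix

namespace Matrix.PosDef

variable {n : Type*} [Fintype n] [DecidableEq n] {Γ : Matrix n n ℝ}

lemma inv_mulVec_mulVec (hΓ : Γ.PosDef) (v : n → ℝ) : Γ⁻¹ *ᵥ (Γ *ᵥ v) = v := by
  rw [mulVec_mulVec, nonsing_inv_mul _ ((isUnit_iff_isUnit_det _).1 hΓ.isUnit), one_mulVec]

lemma mulVec_dotProduct_inv_mulVec (hΓ : Γ.PosDef) (v x : n → ℝ) :
    (Γ *ᵥ v) ⬝ᵥ (Γ⁻¹ *ᵥ x) = v ⬝ᵥ x := by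
  have hsymm : Γ⁻¹ᵀ = Γ⁻¹ := by simpa using hΓ.inv.isHermitian.eq
  rw [dotProduct_mulVec, ← mulVec_transpose, hsymm, hΓ.inv_mulVec_mulVec]

/-- Cauchy–Schwarz inequality between the quadratic forms of `Γ` and `Γ⁻¹`. -/
lemma dotProduct_sq_le (hΓ : Γ.PosDef) (v x : n → ℝ) :
    (v ⬝ᵥ x) ^ 2 ≤ (x ⬝ᵥ (Γ⁻¹ *ᵥ x)) * (v ⬝ᵥ (Γ *ᵥ v)) := by
  have h : ∀ t : ℝ, 0 ≤ v ⬝ᵥ (Γ *ᵥ v) * (t * t) + 2 * (v ⬝ᵥ x) * t + x ⬝ᵥ (Γ⁻¹ *ᵥ x) := by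
    intro t
    have h0 : 0 ≤ (x + t • (Γ *ᵥ v)) ⬝ᵥ (Γ⁻¹ *ᵥ (x + t • (Γ *ᵥ v))) := by
      simpa using hΓ.inv.posSemidef.dotProduct_mulVec_nonneg (x + t • (Γ *ᵥ v))
    simp only [mulVec_add, mulVec_smul, hΓ.inv_mulVec_mulVec, add_dotProduct, dotProduct_add,
      smul_dotProduct, dotProduct_smul, hΓ.mulVec_dotProduct_inv_mulVec, smul_eq_mul,
      dotProduct_comm x v, dotProduct_comm (Γ *ᵥ v) v] at h0
    linarith
  have := discrim_le_zero h
  rw [discrim] at this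
  linarith

/-- The minimum of a linear functional over a centred ellipsoid. -/
lemma isLeast_dotProduct_ellipsoid (hΓ : Γ.PosDef) {κ : ℝ} (hκ : 0 ≤ κ) (v : n → ℝ) :
    IsLeast ((fun x => v ⬝ᵥ x) '' {x | x ⬝ᵥ (Γ⁻¹ *ᵥ x) ≤ κ ^ 2})
      (-(κ * √(v ⬝ᵥ (Γ *ᵥ v)))) := by
  have hq : 0 ≤ v ⬝ᵥ (Γ *ᵥ v) := by
    simpa using hΓ.posSemidef.dotProduct_mulVec_nonneg v
  have hs := Real.sq_sqrt hq
  constructor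
  · refine ⟨(-(κ / √(v ⬝ᵥ (Γ *ᵥ v)))) • (Γ *ᵥ v), ?_, ?_⟩
    · simp only [Set.mem_ofPred_eq, mulVec_smul, smul_dotProduct, dotProduct_smul,
        hΓ.mulVec_dotProduct_inv_mulVec, smul_eq_mul]
      rcases eq_or_ne (√(v ⬝ᵥ (Γ *ᵥ v))) 0 with h | h
      · simp [h, sq_nonneg]
      · apply le_of_eq
        nth_rewrite 3 [← hs]
        field_simp
    · simp only [dotProduct_smul, smul_eq_mul]
      rw [neg_mul, div_mul_eq_mul_div, mul_div_assoc, Real.div_sqrt]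
  · rintro _ ⟨x, hx, rfl⟩
    refine neg_le_of_abs_le (abs_le_of_sq_le_sq ?_ (by positivity))
    rw [mul_pow, hs]
    exact (hΓ.dotProduct_sq_le v x).trans (mul_le_mul_of_nonneg_right hx hq)

end Matrix.PosDef

/-- **Dual function of the demand-relaxed problem (LP_R).**
Relaxing the demand vector into the ellipsoid `E(d̄,Γ,κ)` changes the dual function by
replacing the term `λᵀd` with `λᵀd̄ - κ√(λᵀΓλ)`:
`inf { f(u) + λᵀ(d - A(u)) : u ∈ U, d ∈ E } = inf_u (f(u) - λᵀA(u)) + λᵀd̄ - κ√(λᵀΓλ)`. -/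
theorem stmt9 {U : Type*} [Nonempty U] {D : ℕ} (f : U → ℝ) (A : U → Fin D → ℝ)
    (hbdd : ∀ lam : Fin D → ℝ, BddBelow (Set.range fun u : U => f u - lam ⬝ᵥ A u))
    (dbar : Fin D → ℝ) (Γ : Matrix (Fin D) (Fin D) ℝ) (hΓsymm : Γ.IsSymm) (hΓ : Γ.PosDef)
    (κ : ℝ) (hκ : 0 ≤ κ) (lam : Fin D → ℝ) :
    sInf {y : ℝ | ∃ (u : U) (d : Fin D → ℝ),
        (d - dbar) ⬝ᵥ (Γ⁻¹ *ᵥ (d - dbar)) ≤ κ ^ 2 ∧ y = f u + lam ⬝ᵥ (d - A u)} =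
      (⨅ u : U, (f u - lam ⬝ᵥ A u)) + lam ⬝ᵥ dbar - κ * Real.sqrt (lam ⬝ᵥ (Γ *ᵥ lam)) := by
  obtain ⟨⟨x, hx, hxv⟩, hmin⟩ := hΓ.isLeast_dotProduct_ellipsoid hκ lam
  have split (u : U) (d : Fin D → ℝ) : f u + lam ⬝ᵥ (d - A u) =
      (f u - lam ⬝ᵥ A u) + lam ⬝ᵥ dbar + lam ⬝ᵥ (d - dbar) := by
    simp only [dotProduct_sub]
    ring
  refine IsGLB.csInf_eq ⟨?_, fun b hb => ?_⟩ ?_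
  · rintro _ ⟨u, d, hd, rfl⟩
    have h1 := ciInf_le (hbdd lam) u
    have h2 := hmin ⟨d - dbar, hd, rfl⟩
    dsimp only at h2
    rw [split]
    linarith
  · have h : b - lam ⬝ᵥ dbar + κ * √(lam ⬝ᵥ (Γ *ᵥ lam)) ≤ ⨅ u : U, (f u - lam ⬝ᵥ A u) := by
      refine le_ciInf fun u => ?_
      have hu := hb ⟨u, dbar + x, by simpa using hx, rfl⟩
      rw [split, add_sub_cancel_left] at hu
      dsimp only at hxv
      linarith
    linarith
  · exact ⟨_, Classical.arbitrary U, dbar, by simpa using sq_nonneg κ, rfl⟩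
end

section
/- Let c, λ ∈ ℝ, α ∈ [0,1], let n be a positive integer, κ > 0 and M ≥ 0. Define V(u) := ( α(c − λ) + κ·√(α(1−α)/n)·|c − λ| ) · u for u ∈ [0, M]. Then the point u* defined by u* = 0 if ( c ≥ λ, or c < λ and α ≤ κ²/(κ² + n) ), and u* = M otherwise, is a minimizer of V over the interval [0, M]; that is, V(u*) = inf { V(u) : 0 ≤ u ≤ M }. -/
/-- The risk-corrected availability `κ√(α(1-α)/n)` dominates `α` below the threshold
`κ²/(κ²+n)`. -/
lemma le_mul_sqrt_of_le_threshold {α κ n : ℝ} (hα : α ∈ Set.Icc (0 : ℝ) 1) (hn : 0 < n)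
    (hκ : 0 < κ) (h : α ≤ κ ^ 2 / (κ ^ 2 + n)) : α ≤ κ * √(α * (1 - α) / n) := by
  rw [le_div_iff₀ (by positivity)] at h
  rw [← div_le_iff₀' hκ]
  apply Real.le_sqrt_of_sq_le
  rw [div_pow, div_le_div_iff₀ (by positivity) hn]
  nlinarith [mul_le_mul_of_nonneg_left h hα.1]

/-- The risk-corrected availability `κ√(α(1-α)/n)` is at most `α` above the threshold
`κ²/(κ²+n)`. -/
lemma mul_sqrt_le_of_threshold_le {α κ n : ℝ} (hα : α ∈ Set.Icc (0 : ℝ) 1) (hn : 0 < n)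
    (hκ : 0 < κ) (h : κ ^ 2 / (κ ^ 2 + n) ≤ α) : κ * √(α * (1 - α) / n) ≤ α := by
  rw [div_le_iff₀ (by positivity)] at h
  rw [← le_div_iff₀' hκ]
  apply Real.sqrt_le_iff.mpr ⟨div_nonneg hα.1 hκ.le, ?_⟩
  rw [div_pow, div_le_div_iff₀ hn (by positivity)]
  nlinarith [mul_le_mul_of_nonneg_left h hα.1]

/-- **Closed-form solution of the robustified dual thermal subproblem.**
With `V(u) = (α(c-λ) + κ√(α(1-α)/n)|c-λ|)·u` on `[0,M]`, the command `u* = 0` if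
(`c ≥ λ`, or `c < λ` and `α ≤ κ²/(κ²+n)`) and `u* = M` otherwise, is a minimizer:
`V(u*) = inf { V(u) : 0 ≤ u ≤ M }`. -/
theorem stmt12 (c lam α : ℝ) (hα : α ∈ Set.Icc (0 : ℝ) 1) (n : ℕ) (hn : 1 ≤ n)
    (κ : ℝ) (hκ : 0 < κ) (M : ℝ) (hM : 0 ≤ M)
    (V : ℝ → ℝ)
    (hV : ∀ u : ℝ, V u = (α * (c - lam) + κ * Real.sqrt (α * (1 - α) / n) * |c - lam|) * u)
    (ustar : ℝ)
    (hustar : ustar = if (lam ≤ c ∨ (c < lam ∧ α ≤ κ ^ 2 / (κ ^ 2 + n))) then 0 else M) :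
    ustar ∈ Set.Icc 0 M ∧ V ustar = sInf (V '' Set.Icc 0 M) := by
  have hn' : (0 : ℝ) < n := by exact_mod_cast hn
  suffices h : ustar ∈ Set.Icc 0 M ∧ ∀ u ∈ Set.Icc 0 M, V ustar ≤ V u by
    refine ⟨h.1, (IsLeast.csInf_eq ⟨Set.mem_image_of_mem V h.1, ?_⟩).symm⟩
    rintro _ ⟨u, hu, rfl⟩
    exact h.2 u hu
  simp only [hV]
  split_ifs at hustar with hcond
  · subst hustar
    refine ⟨⟨le_rfl, hM⟩, fun u hu => mul_le_mul_of_nonneg_left hu.1 ?_⟩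
    rcases hcond with hc | ⟨hc, hthr⟩
    · have := mul_nonneg hα.1 (sub_nonneg.mpr hc)
      positivity
    · rw [abs_of_neg (sub_neg.mpr hc)]
      nlinarith [le_mul_sqrt_of_le_threshold hα hn' hκ hthr]
  · subst hustar
    push Not at hcond
    obtain ⟨hc, hthr⟩ := hcond
    refine ⟨⟨hM, le_rfl⟩, fun u hu => mul_le_mul_of_nonpos_left hu.2 ?_⟩
    rw [abs_of_neg (sub_neg.mpr hc)]
    nlinarith [mul_sqrt_le_of_threshold_le hα hn' hκ (hthr hc).le]
end
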